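/- Let n ≥ 1 and let f : {0,1}^{n−1} → {0,1} be a monotone Boolean function. Then the orientation φ_f of the n-cube defined by: v → v⊕i whenever i ≠ n and v_i = 0, and v → v⊕n if and only if v_n + f(v') = 1 (where v' consists of the first n−1 bits of v), is locally uniform. -/

import Mathlib

open Matrix BigOperators

/-- A vertex of the `n`-cube: a bit vector of length `n`. -/
abbrev Vertex (n : ℕ) := Fin n → Bool

/-- An orientation of the `n`-cube, given by its "out-map":
`φ v i = true` means that the edge `{v, v ⊕ i}` is directed from `v` to `v ⊕ i`. -/
abbrev CubeOrientation (n : ℕ) := Vertex n → Fin n → Bool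

/-- `v ⊕ i`: flip the `i`-th bit of `v`. -/
def vflip {n : ℕ} (v : Vertex n) (i : Fin n) : Vertex n :=
  Function.update v i (!(v i))

/-- `u` belongs to the subcube with base vertex `v` and coordinate set `C`. -/
def InSubcube {n : ℕ} (v : Vertex n) (C : Finset (Fin n)) (u : Vertex n) : Prop :=
  ∀ j, j ∉ C → u j = v j

/-- `u` is a sink of the subcube `(v, C)`: all subcube edges at `u` are incoming. -/
def IsSink {n : ℕ} (φ : CubeOrientation n) (v : Vertex n) (C : Finset (Fin n))
    (u : Vertex n) : Prop :=
  InSubcube v C u ∧ ∀ i ∈ C, φ u i = false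

/-- `u` is a source of the subcube `(v, C)`: all subcube edges at `u` are outgoing. -/
def IsSource {n : ℕ} (φ : CubeOrientation n) (v : Vertex n) (C : Finset (Fin n))
    (u : Vertex n) : Prop :=
  InSubcube v C u ∧ ∀ i ∈ C, φ u i = true

/-- Unique-sink orientation: every subcube has a unique sink. -/
def IsUSO {n : ℕ} (φ : CubeOrientation n) : Prop :=
  ∀ (v : Vertex n) (C : Finset (Fin n)), ∃! u, IsSink φ v C u

/-- One directed step along an edge of the orientation. -/
def OrientStep {n : ℕ} (φ : CubeOrientation n) (u w : Vertex n) : Prop :=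
  ∃ i, φ u i = true ∧ w = vflip u i

/-- Acyclicity: no directed cycle. -/
def IsAcyclic {n : ℕ} (φ : CubeOrientation n) : Prop :=
  ∀ u, ¬ Relation.TransGen (OrientStep φ) u u

/-- Local uniformity of an orientation. -/
def LocallyUniform {n : ℕ} (φ : CubeOrientation n) : Prop :=
  (∀ (u : Vertex n) (i j : Fin n), i ≠ j → u i = false → u j = false →
      φ u i = true → φ u j = true →
      φ (vflip u i) j = true ∧ φ (vflip u j) i = true) ∧
  (∀ (u : Vertex n) (i j : Fin n), i ≠ j → u i = false → u j = false →
      φ (vflip u i) i = true → φ (vflip u j) j = true →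
      φ (vflip (vflip u i) j) j = true ∧ φ (vflip (vflip u j) i) i = true)

/-- `p` is a directed path from `s` to `t` inside the subcube `(v, C)`. -/
def IsDirPathIn {n : ℕ} (φ : CubeOrientation n) (v : Vertex n) (C : Finset (Fin n))
    (s t : Vertex n) (p : List (Vertex n)) : Prop :=
  p.head? = some s ∧ p.getLast? = some t ∧ p.Nodup ∧
  (∀ u ∈ p, InSubcube v C u) ∧
  p.Chain' (fun a b => ∃ i ∈ C, φ a i = true ∧ b = vflip a i)

/-- The Holt–Klee property: in every subcube of dimension `d`, there are `d` directed
paths from the source to the sink, pairwise sharing no vertex besides source and sink. -/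
def HoltKlee {n : ℕ} (φ : CubeOrientation n) : Prop :=
  IsUSO φ ∧
  ∀ (v : Vertex n) (C : Finset (Fin n)) (s t : Vertex n),
    IsSource φ v C s → IsSink φ v C t →
    ∃ P : Fin C.card → List (Vertex n),
      (∀ k, IsDirPathIn φ v C s t (P k)) ∧
      ∀ k l, k ≠ l → ∀ u, u ∈ P k → u ∈ P l → u = s ∨ u = t

/-- `φ^{(F)}`: reverse all edges in the coordinates belonging to `F`. -/
def Reorient {n : ℕ} (φ : CubeOrientation n) (F : Finset (Fin n)) : CubeOrientation n :=
  fun v i => if i ∈ F then φ (vflip v i) i else φ v i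

/-- Strong Holt–Klee property. -/
def StronglyHoltKlee {n : ℕ} (φ : CubeOrientation n) : Prop :=
  ∀ F : Finset (Fin n), HoltKlee (Reorient φ F)

/-- A P-matrix: all principal minors are positive. -/
def IsPMatrix {n : ℕ} (M : Matrix (Fin n) (Fin n) ℝ) : Prop :=
  ∀ S : Finset (Fin n), S.Nonempty →
    0 < (M.submatrix (fun i : S => (i : Fin n)) (fun i : S => (i : Fin n))).det

/-- A Z-matrix: all off-diagonal entries are non-positive. -/
def IsZMatrix {n : ℕ} (M : Matrix (Fin n) (Fin n) ℝ) : Prop :=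
  ∀ i j, i ≠ j → M i j ≤ 0

/-- A K-matrix: both a Z-matrix and a P-matrix. -/
def IsKMatrix {n : ℕ} (M : Matrix (Fin n) (Fin n) ℝ) : Prop :=
  IsZMatrix M ∧ IsPMatrix M

/-- The matrix `A_B`: its `s`-th column is the `s`-th column of `-M` if `s ∈ B`,
and the `s`-th column of the identity matrix otherwise. -/
def ABmat {n : ℕ} (M : Matrix (Fin n) (Fin n) ℝ) (B : Finset (Fin n)) :
    Matrix (Fin n) (Fin n) ℝ :=
  fun r s => if s ∈ B then -(M r s) else if r = s then 1 else 0

/-- The vector `A_B⁻¹ q`. -/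
noncomputable def lcpVal {n : ℕ} (M : Matrix (Fin n) (Fin n) ℝ) (q : Fin n → ℝ)
    (B : Finset (Fin n)) : Fin n → ℝ :=
  (ABmat M B)⁻¹ *ᵥ q

/-- `q` is nondegenerate for `M`: `(A_B⁻¹ q)_i ≠ 0` for all `B` and `i`. -/
def Nondegenerate {n : ℕ} (M : Matrix (Fin n) (Fin n) ℝ) (q : Fin n → ℝ) : Prop :=
  ∀ (B : Finset (Fin n)) (i : Fin n), lcpVal M q B i ≠ 0

/-- `B(v) = {j : v_j = 1}`. -/
def vertexBasis {n : ℕ} (v : Vertex n) : Finset (Fin n) :=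
  Finset.univ.filter (fun j => v j = true)

/-- The orientation induced by `LCP(M, q)`: `v → v ⊕ i` iff `(A_{B(v)}⁻¹ q)_i < 0`. -/
noncomputable def inducedOrientation {n : ℕ} (M : Matrix (Fin n) (Fin n) ℝ)
    (q : Fin n → ℝ) : CubeOrientation n :=
  fun v i => decide (lcpVal M q (vertexBasis v) i < 0)

/-- A P-USO: an orientation induced by an LCP with a P-matrix and nondegenerate `q`. -/
def IsPUSO {n : ℕ} (φ : CubeOrientation n) : Prop :=
  ∃ (M : Matrix (Fin n) (Fin n) ℝ) (q : Fin n → ℝ),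
    IsPMatrix M ∧ Nondegenerate M q ∧ φ = inducedOrientation M q

/-- A K-USO: an orientation induced by an LCP with a K-matrix and nondegenerate `q`. -/
def IsKUSO {n : ℕ} (φ : CubeOrientation n) : Prop :=
  ∃ (M : Matrix (Fin n) (Fin n) ℝ) (q : Fin n → ℝ),
    IsKMatrix M ∧ Nondegenerate M q ∧ φ = inducedOrientation M q

/-- The orientation `φ_f` of the `(n+1)`-cube built from a Boolean function
`f` on the first `n` bits: `v → v ⊕ i` for `i ≠ n` iff `v_i = 0`, and
`v → v ⊕ n` iff `v_n + f(v') = 1` where `v'` is the first `n` bits of `v`. -/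
def develinUSO {n : ℕ} (f : (Fin n → Bool) → Bool) : CubeOrientation (n + 1) :=
  fun v i =>
    if i = Fin.last n then (v (Fin.last n) != f (fun j => v j.castSucc))
    else !(v i)

theorem le_vflip {n : ℕ} {u : Vertex n} {i : Fin n} (h : u i = false) : u ≤ vflip u i := by
  simp [vflip, h]

theorem vflip_self {n : ℕ} (u : Vertex n) (i : Fin n) : vflip u i i = !(u i) := by
  simp [vflip]

theorem vflip_of_ne {n : ℕ} (u : Vertex n) {i j : Fin n} (h : j ≠ i) : vflip u i j = u j := by
  simp [vflip, h]

theorem develinUSO_of_ne_last {n : ℕ} (f : (Fin n → Bool) → Bool) (v : Vertex (n + 1))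
    {i : Fin (n + 1)} (h : i ≠ Fin.last n) : develinUSO f v i = !(v i) := by
  simp [develinUSO, h]

theorem develinUSO_last {n : ℕ} (f : (Fin n → Bool) → Bool) (v : Vertex (n + 1)) :
    develinUSO f v (Fin.last n) = (v (Fin.last n) != f (fun j => v j.castSucc)) := by
  simp [develinUSO]

/-- Moving up along a coordinate preserves an outgoing edge in another coordinate
at a vertex with bit `0` there. -/
theorem develinUSO_vflip_of_outgoing {n : ℕ} {f : (Fin n → Bool) → Bool} (hf : Monotone f)
    {u : Vertex (n + 1)} {i j : Fin (n + 1)} (hij : i ≠ j) (hi : u i = false)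
    (hj : u j = false) (h : develinUSO f u j = true) :
    develinUSO f (vflip u i) j = true := by
  by_cases hl : j = Fin.last n
  · subst hl
    rw [develinUSO_last, hj, Bool.false_bne] at h
    rw [develinUSO_last, vflip_of_ne u hij.symm, hj, Bool.false_bne]
    exact hf (fun k => le_vflip hi k.castSucc) h
  · rw [develinUSO_of_ne_last f _ hl, vflip_of_ne u hij.symm, hj, Bool.not_false]

/-- An edge leaving its upper endpoint lies in the last coordinate. -/
theorem eq_last_of_develinUSO_vflip {n : ℕ} {f : (Fin n → Bool) → Bool}
    {u : Vertex (n + 1)} {i : Fin (n + 1)} (hi : u i = false)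
    (h : develinUSO f (vflip u i) i = true) : i = Fin.last n := by
  by_contra hl
  simp [develinUSO_of_ne_last f _ hl, vflip_self, hi] at h

theorem stmt14 (n : ℕ) (f : (Fin n → Bool) → Bool) (hf : Monotone f) :
    LocallyUniform (develinUSO f) := by
  refine ⟨fun u i j hij hi hj h₁ h₂ => ?_, fun u i j hij hi hj h₁ h₂ => ?_⟩
  · exact ⟨develinUSO_vflip_of_outgoing hf hij hi hj h₂,
      develinUSO_vflip_of_outgoing hf hij.symm hj hi h₁⟩
  · exact absurd ((eq_last_of_develinUSO_vflip hi h₁).trans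
      (eq_last_of_develinUSO_vflip hj h₂).symm) hij
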